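/- Let k be a field of characteristic ≠ 2 and let Q1, Q2 be quadratic forms on k^6 with Gram matrices M1, M2. If X = {Q1 = 0} ∩ {Q2 = 0} ⊂ ℙ^5_k is a smooth complete intersection of dimension 3, then the binary sextic form F(t0, t1) = det(t0·M1 - t1·M2) is not identically zero and has 6 distinct roots in ℙ^1 over an algebraic closure of k. -/

import Mathlib

open Matrix

open Module in
/-- If no eigenvector of a self-adjoint endomorphism is isotropic, every generalized eigenvector
is an eigenvector. -/
theorem apply_eq_smul_of_mem_maxGenEigenspace {K V : Type*} [Field K] [AddCommGroup V]
    [Module K V] (β : LinearMap.BilinForm K V) (T : End K V)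
    (hadj : ∀ x y, β (T x) y = β x (T y))
    (haniso : ∀ (μ : K) (v : V), v ≠ 0 → T v = μ • v → β v v ≠ 0)
    {μ : K} {w : V} (hw : w ∈ T.maxGenEigenspace μ) : T w = μ • w := by
  have hsemi : ∀ w : V, (T - algebraMap K (End K V) μ)
      ((T - algebraMap K (End K V) μ) w) = 0 → (T - algebraMap K (End K V) μ) w = 0 := by
    intro w hw
    by_contra hne
    refine haniso μ _ hne ?_ ?_
    · simpa [sub_eq_zero, Module.algebraMap_end_apply] using hw
    · have h : ∀ x y, β ((T - algebraMap K (End K V) μ) x) y =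
          β x ((T - algebraMap K (End K V) μ) y) := by
        intro x y
        simp [Module.algebraMap_end_apply, hadj]
      rw [h, hw, map_zero]
  have hgen : ∀ n : ℕ, ((T - algebraMap K (End K V) μ) ^ n) w = 0 →
      (T - algebraMap K (End K V) μ) w = 0 := by
    intro n
    induction n with
    | zero => intro h; rw [pow_zero, End.one_apply] at h; rw [h, map_zero]
    | succ n ih =>
      intro h
      cases n with
      | zero => simpa using h
      | succ n =>
        refine ih ?_
        rw [pow_succ', End.mul_apply]
        refine hsemi _ ?_
        rwa [pow_succ', pow_succ', End.mul_apply, End.mul_apply] at h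
  obtain ⟨n, hn⟩ := (End.mem_maxGenEigenspace T μ w).1 hw
  simpa [sub_eq_zero, Module.algebraMap_end_apply] using
    hgen n (by simpa [Algebra.algebraMap_eq_smul_one] using hn)

/-- If no eigenvector is isotropic for some bilinear form, eigenspaces are at most lines. -/
theorem exists_eq_smul_of_apply_eq_smul {K V : Type*} [Field K] [IsAlgClosed K]
    [AddCommGroup V] [Module K V] (β : LinearMap.BilinForm K V) (T : Module.End K V)
    (haniso : ∀ (μ : K) (v : V), v ≠ 0 → T v = μ • v → β v v ≠ 0)
    {μ : K} {u w : V} (hu : u ≠ 0) (hTu : T u = μ • u) (hTw : T w = μ • w) :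
    ∃ c : K, w = c • u := by
  have hdeg := Polynomial.degree_quadratic (b := β u w + β w u) (c := β w w)
    (haniso μ u hu hTu)
  obtain ⟨x, hx⟩ := IsAlgClosed.exists_root _ (by rw [hdeg]; decide)
  simp only [Polynomial.IsRoot, Polynomial.eval_add, Polynomial.eval_mul, Polynomial.eval_C,
    Polynomial.eval_pow, Polynomial.eval_X] at hx
  refine ⟨-x, ?_⟩
  by_contra hne
  refine haniso μ (w + x • u) ?_ ?_ ?_
  · intro h
    exact hne (by rw [neg_smul]; exact eq_neg_of_add_eq_zero_left h)
  · rw [map_add, map_smul, hTu, hTw, smul_add, smul_comm]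
  · simp only [map_add, map_smul, LinearMap.add_apply, LinearMap.smul_apply, smul_eq_mul]
    linear_combination hx

open Module in
/-- An endomorphism that is self-adjoint for a bilinear form with no isotropic eigenvector
has as many eigenvalues as the dimension of the space. -/
theorem ncard_hasEigenvalue_eq_finrank {K V : Type*} [Field K] [IsAlgClosed K] [AddCommGroup V]
    [Module K V] [FiniteDimensional K V] (β : LinearMap.BilinForm K V) (T : End K V)
    (hadj : ∀ x y, β (T x) y = β x (T y))
    (haniso : ∀ (μ : K) (v : V), v ≠ 0 → T v = μ • v → β v v ≠ 0) :
    Set.ncard {μ : K | T.HasEigenvalue μ} = finrank K V := by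
  have hex : ∀ μ : {μ : K | T.HasEigenvalue μ}, ∃ v, T.HasEigenvector μ v := fun μ =>
    End.HasEigenvalue.exists_hasEigenvector μ.2
  choose u hu using hex
  have hli : LinearIndependent K u := End.eigenvectors_linearIndependent T _ u hu
  have hspan : ⊤ ≤ Submodule.span K (Set.range u) := by
    rw [← End.iSup_maxGenEigenspace_eq_top T]
    refine iSup_le fun μ w hw => ?_
    by_cases hw0 : w = 0
    · rw [hw0]; exact Submodule.zero_mem _
    have hTw := apply_eq_smul_of_mem_maxGenEigenspace β T hadj haniso hw
    have hμ : T.HasEigenvalue μ :=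
      End.hasEigenvalue_of_hasEigenvector ⟨End.mem_eigenspace_iff.2 hTw, hw0⟩
    obtain ⟨c, hc⟩ := exists_eq_smul_of_apply_eq_smul β T haniso (hu ⟨μ, hμ⟩).2
      (hu ⟨μ, hμ⟩).apply_eq_smul hTw
    rw [hc]
    exact Submodule.smul_mem _ _ (Submodule.subset_span ⟨_, rfl⟩)
  rw [finrank_eq_nat_card_basis (Basis.mk hli hspan),
    Nat.card_coe_set_eq]

/-- If the kernel vectors of all members `A - t B` of a pencil of symmetric matrices over an
infinite field are anisotropic for `B`, then some member is nonsingular. -/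
theorem exists_det_sub_smul_ne_zero {K n : Type*} [Field K] [Infinite K] [Fintype n]
    [DecidableEq n] (A B : Matrix n n K) (hA : A.IsSymm) (hB : B.IsSymm)
    (haniso : ∀ (t : K) (v : n → K), v ≠ 0 → A *ᵥ v = t • B *ᵥ v → v ⬝ᵥ B *ᵥ v ≠ 0) :
    ∃ t : K, (A - t • B).det ≠ 0 := by
  by_contra! hdet
  choose v hv0 hv using fun t => Matrix.exists_mulVec_eq_zero_iff.2 (hdet t)
  have hv' : ∀ t, A *ᵥ v t = t • B *ᵥ v t := fun t => by
    simpa [Matrix.sub_mulVec, Matrix.smul_mulVec, sub_eq_zero] using hv t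
  have hsymm : ∀ {M : Matrix n n K}, M.IsSymm → ∀ x y, x ⬝ᵥ M *ᵥ y = y ⬝ᵥ M *ᵥ x := by
    intro M hM x y
    rw [Matrix.dotProduct_mulVec, ← Matrix.mulVec_transpose, hM.eq, dotProduct_comm]
  have hli : LinearIndependent K v := by
    refine LinearMap.BilinForm.linearIndependent_of_iIsOrtho (B := Matrix.toBilin' B) ?_ ?_
    · intro s t hst
      have h := hsymm hA (v s) (v t)
      rw [hv', hv', dotProduct_smul, dotProduct_smul, hsymm hB (v t), smul_eq_mul,
        smul_eq_mul] at h
      have h0 : (t - s) * (v s ⬝ᵥ B *ᵥ v t) = 0 := by linear_combination h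
      exact (Matrix.toBilin'_apply' B _ _).trans
        ((mul_eq_zero.1 h0).resolve_left (sub_ne_zero.2 hst.symm))
    · intro t ht
      exact haniso t (v t) (hv0 t) (hv' t)
        ((Matrix.toBilin'_apply' B _ _).symm.trans ht)
  exact not_finite_iff_infinite.2 ‹Infinite K› hli.finite

/-- If `N` is a nonsingular member of a pencil of symmetric matrices spanned by `N` and `L`, and
no kernel vector of a member is isotropic for `N`, the eigenvalue problem `L v = μ N v` has
as many solutions `μ` as the size of the matrices. -/
theorem ncard_det_sub_smul_eq_zero {K n : Type*} [Field K] [IsAlgClosed K] [Fintype n]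
    [DecidableEq n] (N L : Matrix n n K) (hN : N.IsSymm) (hL : L.IsSymm) (hdet : N.det ≠ 0)
    (haniso : ∀ (μ : K) (v : n → K), v ≠ 0 → L *ᵥ v = μ • N *ᵥ v → v ⬝ᵥ N *ᵥ v ≠ 0) :
    Set.ncard {μ : K | (L - μ • N).det = 0} = Fintype.card n := by
  have hunit : IsUnit N.det := isUnit_iff_ne_zero.2 hdet
  have hNT : ∀ v, N *ᵥ ((N⁻¹ * L) *ᵥ v) = L *ᵥ v := fun v => by
    rw [Matrix.mulVec_mulVec, Matrix.mul_nonsing_inv_cancel_left _ _ hunit]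
  have heig : ∀ (μ : K) v, (N⁻¹ * L) *ᵥ v = μ • v ↔ L *ᵥ v = μ • N *ᵥ v := by
    intro μ v
    refine ⟨fun h => by rw [← hNT, h, Matrix.mulVec_smul], fun h => ?_⟩
    rw [← Matrix.mulVec_mulVec, h, Matrix.mulVec_smul, Matrix.mulVec_mulVec,
      Matrix.nonsing_inv_mul _ hunit, Matrix.one_mulVec]
  have hcard := ncard_hasEigenvalue_eq_finrank (Matrix.toBilin' N) (Matrix.toLin' (N⁻¹ * L))
    (by
      intro x y
      rw [Matrix.toBilin'_apply', Matrix.toBilin'_apply', Matrix.toLin'_apply,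
        Matrix.toLin'_apply, hNT, Matrix.dotProduct_mulVec, ← Matrix.mulVec_transpose, hN.eq,
        hNT, Matrix.dotProduct_mulVec x, ← Matrix.mulVec_transpose, hL.eq])
    (by
      intro μ v hv h
      rw [Matrix.toBilin'_apply']
      exact haniso μ v hv ((heig μ v).1 (by simpa using h)))
  rw [Module.finrank_fintype_fun_eq_card] at hcard
  rw [← hcard]
  congr 1
  ext μ
  rw [Set.mem_ofPred_eq, Set.mem_ofPred_eq, ← Matrix.exists_mulVec_eq_zero_iff]
  constructor
  · rintro ⟨v, hv0, hv⟩
    refine Module.End.hasEigenvalue_of_hasEigenvector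
      ⟨Module.End.mem_eigenspace_iff.2 ?_, hv0⟩
    rw [Matrix.toLin'_apply, heig]
    simpa [Matrix.sub_mulVec, Matrix.smul_mulVec, sub_eq_zero] using hv
  · intro h
    obtain ⟨v, hv⟩ := h.exists_hasEigenvector
    refine ⟨v, hv.2, ?_⟩
    have h := (heig μ v).1 (by simpa using hv.apply_eq_smul)
    rw [Matrix.sub_mulVec, Matrix.smul_mulVec, h, sub_self]

/-- The zeros in the projective line of `det (t₀ A - t₁ B)` correspond to the zeros `μ` of
`det (L - μ N)`, where `N = A - t B` is nonsingular and `L = -B`. -/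
theorem ncard_projectivization_det_eq_zero {K n : Type*} [Field K] [Fintype n] [DecidableEq n]
    (A B : Matrix n n K) (t : K) (ht : (A - t • B).det ≠ 0) :
    Set.ncard {P : Projectivization K (Fin 2 → K) | (P.rep 0 • A - P.rep 1 • B).det = 0} =
      Set.ncard {μ : K | (-B - μ • (A - t • B)).det = 0} := by
  have hne : ∀ μ : K, ![-μ, 1 - μ * t] ≠ 0 := by
    intro μ h
    have h0 : -μ = 0 := congrFun h 0
    have h1 : 1 - μ * t = 0 := congrFun h 1
    exact one_ne_zero (by linear_combination h1 - t * h0 : (1 : K) = 0)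
  have hmem : ∀ (v : Fin 2 → K) (hv : v ≠ 0),
      (((Projectivization.mk K v hv).rep 0 • A - (Projectivization.mk K v hv).rep 1 • B).det = 0 ↔
        (v 0 • A - v 1 • B).det = 0) := by
    intro v hv
    obtain ⟨a, ha⟩ := Projectivization.exists_smul_eq_mk_rep K v hv
    rw [← ha]
    simp only [Pi.smul_apply, Units.smul_def, smul_assoc, ← smul_sub, Matrix.det_smul]
    simp
  have hmember : ∀ μ : K, -μ • A - (1 - μ * t) • B = -B - μ • (A - t • B) := by
    intro μ
    module
  symm
  refine Set.ncard_congr (fun μ _ => Projectivization.mk K ![-μ, 1 - μ * t] (hne μ)) ?_ ?_ ?_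
  · intro μ hμ
    refine (hmem _ _).2 ?_
    change (-μ • A - (1 - μ * t) • B).det = 0
    rwa [hmember]
  · intro μ ν _ _ h
    obtain ⟨a, ha⟩ := (Projectivization.mk_eq_mk_iff' K _ _ _ _).1 h
    have h0 : a * -ν = -μ := congrFun ha 0
    have h1 : a * (1 - ν * t) = 1 - μ * t := congrFun ha 1
    have ha1 : a = 1 := by linear_combination h1 - t * h0
    rw [ha1] at h0
    linear_combination h0
  · intro P
    induction P using Projectivization.ind with | h v hv => ?_
    intro hP
    have hP' := (hmem v hv).1 hP
    have hy : v 1 - t * v 0 ≠ 0 := by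
      intro hy
      have h1 : v 1 = t * v 0 := by linear_combination hy
      have hmat : v 0 • A - v 1 • B = v 0 • (A - t • B) := by rw [h1]; module
      rw [hmat, Matrix.det_smul] at hP'
      have h0 := eq_zero_of_pow_eq_zero ((mul_eq_zero.1 hP').resolve_right ht)
      apply hv
      ext i
      fin_cases i
      · exact h0
      · simp [h1, h0]
    have hscale : (v 1 - t * v 0) • ![-(-v 0 / (v 1 - t * v 0)),
        1 - (-v 0 / (v 1 - t * v 0)) * t] = v := by
      ext i
      fin_cases i
      · simp [field]
      · simp [field]
    refine ⟨-v 0 / (v 1 - t * v 0), ?_, ?_⟩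
    · have hmat : v 0 • A - v 1 • B = (v 1 - t * v 0) •
          (-B - (-v 0 / (v 1 - t * v 0)) • (A - t • B)) := by
        rw [smul_sub, smul_smul, mul_div_cancel₀ _ hy]
        module
      rw [hmat, Matrix.det_smul] at hP'
      exact (mul_eq_zero.1 hP').resolve_left (pow_ne_zero _ hy)
    · exact (Projectivization.mk_eq_mk_iff' K _ _ _ _).2 ⟨(v 1 - t * v 0)⁻¹, by
        rw [inv_smul_eq_iff₀ hy, hscale]⟩

/-- Let `Q1, Q2` be quadratic forms on `k^6` (char `k ≠ 2`) with symmetric Gram matrices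
`M1, M2`, and suppose `X = {Q1 = 0} ∩ {Q2 = 0} ⊂ ℙ^5` is a smooth complete intersection
(Jacobian criterion: at every point of `X` over the algebraic closure `K`, the gradients
`M1·v, M2·v` are linearly independent, i.e. the 2×6 Jacobian has rank 2). Then the binary
sextic form `F(t0,t1) = det(t0·M1 - t1·M2)` is not identically zero and has exactly 6
distinct roots in `ℙ^1(K)`. -/
theorem stmt_10 (k : Type*) [Field k] (hchar : ringChar k ≠ 2)
    (M1 M2 : Matrix (Fin 6) (Fin 6) k) (hM1 : M1.IsSymm) (hM2 : M2.IsSymm)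
    (hsmooth : ∀ v : Fin 6 → AlgebraicClosure k, v ≠ 0 →
      v ⬝ᵥ (M1.map (algebraMap k (AlgebraicClosure k))).mulVec v = 0 →
      v ⬝ᵥ (M2.map (algebraMap k (AlgebraicClosure k))).mulVec v = 0 →
      LinearIndependent (AlgebraicClosure k)
        ![(M1.map (algebraMap k (AlgebraicClosure k))).mulVec v,
          (M2.map (algebraMap k (AlgebraicClosure k))).mulVec v]) :
    (∃ t0 t1 : AlgebraicClosure k,
      (t0 • M1.map (algebraMap k (AlgebraicClosure k)) -
        t1 • M2.map (algebraMap k (AlgebraicClosure k))).det ≠ 0) ∧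
    Set.ncard {P : Projectivization (AlgebraicClosure k) (Fin 2 → AlgebraicClosure k) |
      (P.rep 0 • M1.map (algebraMap k (AlgebraicClosure k)) -
        P.rep 1 • M2.map (algebraMap k (AlgebraicClosure k))).det = 0} = 6 := by
  set A := M1.map (algebraMap k (AlgebraicClosure k))
  set B := M2.map (algebraMap k (AlgebraicClosure k))
  have hA : A.IsSymm := hM1.map _
  have hB : B.IsSymm := hM2.map _
  obtain ⟨t, ht⟩ := exists_det_sub_smul_ne_zero A B hA hB (by
    intro t v hv h hBv
    have hAv : v ⬝ᵥ A *ᵥ v = 0 := by rw [h, dotProduct_smul, hBv, smul_zero]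
    have h1 := (LinearIndependent.pair_iff.1 (hsmooth v hv hAv hBv) 1 (-t) (by
      rw [h]; module)).1
    exact one_ne_zero h1)
  refine ⟨⟨1, t, by rwa [one_smul]⟩, ?_⟩
  rw [ncard_projectivization_det_eq_zero A B t ht, ncard_det_sub_smul_eq_zero (A - t • B) (-B)
    (hA.sub (hB.smul t)) hB.neg ht, Fintype.card_fin]
  intro μ v hv h hNv
  have hBv : v ⬝ᵥ B *ᵥ v = 0 := by
    have h' := congrArg (v ⬝ᵥ ·) h
    simpa [Matrix.neg_mulVec, hNv] using h'
  have hAv : v ⬝ᵥ A *ᵥ v = 0 := by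
    simpa [Matrix.sub_mulVec, Matrix.smul_mulVec, hBv] using hNv
  rw [Matrix.neg_mulVec, Matrix.sub_mulVec, Matrix.smul_mulVec] at h
  obtain ⟨h0, h1⟩ := LinearIndependent.pair_iff.1 (hsmooth v hv hAv hBv) μ (1 - μ * t) (by
    linear_combination (norm := module) -h)
  rw [h0] at h1
  simp at h1
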